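/- Let N ≥ 1 and let (e^{itΔ})_{t∈ℝ} be the free Schrödinger group on L²(ℝ^N). For every u₀ ∈ L²(ℝ^N) and all real numbers k > k' ≥ 0, lim_{t→±∞} ‖e^{itΔ}u₀‖_{L²({x : k'|t| < |x| < k|t|})} = ‖ℱ^{−1}u₀‖_{L²({x : k'/2 < |x| < k/2})}, where ℱ^{−1} denotes the inverse Fourier transform on ℝ^N. -/

import Mathlib

noncomputable section

abbrev EucSp (N : ℕ) : Type := EuclideanSpace ℝ (Fin N)

open MeasureTheory Filter Metric Set Complex ENNReal RealInnerProductSpace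

open FourierTransform SchwartzMap in
lemma kernel_eps {N : ℕ} (u : 𝓢(EucSp N, ℂ)) (b : ℂ) (hb : 0 < b.re) (x : EucSp N) :
    ∫ η, cexp (-b * ‖η‖ ^ 2 + 2 * Real.pi * Complex.I * (⟪x, η⟫ : ℝ)) * (𝓕 (u : EucSp N → ℂ)) η
      = (Real.pi / b) ^ (N / 2 : ℂ) * ∫ y, cexp (-Real.pi ^ 2 * ‖x - y‖ ^ 2 / b) * u y := by
  have h1 : Integrable (fun v : EucSp N => cexp (-b * ‖v‖ ^ 2 + 2 * Real.pi * Complex.I * (⟪x, v⟫ : ℝ))) :=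
    GaussianFourier.integrable_cexp_neg_mul_sq_norm_add hb _ _
  have h := VectorFourier.integral_fourierIntegral_smul_eq_flip (L := innerₗ (EucSp N))
      Real.continuous_fourierChar continuous_inner h1 (u.integrable (μ := volume))
  have h2 := fun w : EucSp N => fourier_gaussian_innerProductSpace' hb x w
  rw [finrank_euclideanSpace_fin] at h2
  have e1 : ∀ f : EucSp N → ℂ, VectorFourier.fourierIntegral Real.fourierChar volume (innerₗ (EucSp N)).flip f = 𝓕 f := by
    intro f; rw [flip_innerₗ]; rfl
  have e2 : ∀ f : EucSp N → ℂ, VectorFourier.fourierIntegral Real.fourierChar volume (innerₗ (EucSp N)) f = 𝓕 f := by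
    intro f; rfl
  rw [e1, e2] at h
  simp only [smul_eq_mul, h2] at h
  rw [← h, ← integral_const_mul]
  simp only [mul_assoc]

open FourierTransform SchwartzMap in
lemma kernel {N : ℕ} (u : 𝓢(EucSp N, ℂ)) (t : ℝ) (ht : t ≠ 0) (x : EucSp N) :
    ∫ η, cexp (-(4 * Real.pi ^ 2 * t * I) * ‖η‖ ^ 2 + 2 * Real.pi * Complex.I * (⟪x, η⟫ : ℝ)) * (𝓕 (u : EucSp N → ℂ)) η
      = (Real.pi / (4 * Real.pi ^ 2 * t * I)) ^ (N / 2 : ℂ) * ∫ y, cexp (-Real.pi ^ 2 * ‖x - y‖ ^ 2 / (4 * Real.pi ^ 2 * t * I)) * u y := by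
  set b : ℂ := 4 * Real.pi ^ 2 * t * I with hbdef
  have hpi := Real.pi_ne_zero
  have hb0 : b ≠ 0 := by simp [b, ht, hpi]
  have hbre : b.re = 0 := by
    simp [b, ← Complex.ofReal_pow]
  have hB : Tendsto (fun ε : ℝ => b + ε) (nhdsWithin 0 (Ioi 0)) (nhds b) := by
    have : Continuous (fun ε : ℝ => b + ε) := by fun_prop
    simpa using (this.tendsto 0).mono_left nhdsWithin_le_nhds
  have hpos : ∀ᶠ ε : ℝ in nhdsWithin 0 (Ioi 0), 0 < (b + ε).re := by
    filter_upwards [self_mem_nhdsWithin] with ε hε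
    simpa [hbre] using hε
  have hL : Tendsto (fun ε : ℝ => ∫ η, cexp (-(b + ε) * ‖η‖ ^ 2 + 2 * Real.pi * Complex.I * (⟪x, η⟫ : ℝ)) * (𝓕 (u : EucSp N → ℂ)) η)
      (nhdsWithin 0 (Ioi 0)) (nhds (∫ η, cexp (-b * ‖η‖ ^ 2 + 2 * Real.pi * Complex.I * (⟪x, η⟫ : ℝ)) * (𝓕 (u : EucSp N → ℂ)) η)) := by
    have hc : Continuous (𝓕 (u : EucSp N → ℂ)) := by
      rw [← SchwartzMap.fourier_coe]; exact (𝓕 u).continuous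
    have hi : Integrable (𝓕 (u : EucSp N → ℂ)) := by
      rw [← SchwartzMap.fourier_coe]; exact (𝓕 u).integrable
    refine tendsto_integral_filter_of_dominated_convergence (fun η => ‖(𝓕 (u : EucSp N → ℂ)) η‖) ?_ ?_ hi.norm ?_
    · refine Eventually.of_forall fun ε => ?_
      exact Continuous.aestronglyMeasurable (by fun_prop)
    · filter_upwards [hpos] with ε hε
      refine Eventually.of_forall fun η => ?_
      rw [norm_mul, norm_exp]
      refine mul_le_of_le_one_left (norm_nonneg _) (Real.exp_le_one_iff.2 ?_)
      have : (-(b + ε) * (‖η‖:ℂ) ^ 2 + 2 * Real.pi * Complex.I * (⟪x, η⟫ : ℝ)).re = -((b+ε).re * ‖η‖^2) := by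
        simp [← Complex.ofReal_pow]; ring
      rw [this]
      have := mul_nonneg hε.le (sq_nonneg ‖η‖)
      linarith
    · refine Eventually.of_forall fun η => ?_
      refine Tendsto.mul_const _ ?_
      have : Continuous (fun z : ℂ => cexp (-z * ‖η‖ ^ 2 + 2 * Real.pi * Complex.I * (⟪x, η⟫ : ℝ))) := by fun_prop
      exact (this.tendsto b).comp hB
  have hR : Tendsto (fun ε : ℝ => (Real.pi / (b + ε)) ^ (N / 2 : ℂ) * ∫ y, cexp (-Real.pi ^ 2 * ‖x - y‖ ^ 2 / (b + ε)) * u y)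
      (nhdsWithin 0 (Ioi 0)) (nhds ((Real.pi / b) ^ (N / 2 : ℂ) * ∫ y, cexp (-Real.pi ^ 2 * ‖x - y‖ ^ 2 / b) * u y)) := by
    refine Tendsto.mul ?_ ?_
    · refine Tendsto.cpow (tendsto_const_nhds.div hB hb0) tendsto_const_nhds ?_
      refine Or.inr ?_
      have : (Real.pi / b : ℂ) = ((-(Real.pi / (4 * Real.pi ^ 2 * t)) : ℝ) : ℂ) * I := by
        have : (Real.pi : ℂ) ≠ 0 := by simp [hpi]
        have : (t : ℂ) ≠ 0 := by simp [ht]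
        rw [hbdef]; push_cast; field_simp; simp
      rw [this]
      rw [im_ofReal_mul, I_im, mul_one]
      refine neg_ne_zero.2 ?_
      positivity
    · refine tendsto_integral_filter_of_dominated_convergence (fun η => ‖u η‖) ?_ ?_ u.integrable.norm ?_
      · refine Eventually.of_forall fun ε => ?_
        have := u.continuous
        exact Continuous.aestronglyMeasurable (by fun_prop)
      · filter_upwards [hpos] with ε hε
        refine Eventually.of_forall fun η => ?_
        rw [norm_mul, norm_exp]
        refine mul_le_of_le_one_left (norm_nonneg _) (Real.exp_le_one_iff.2 ?_)
        have : (-Real.pi ^ 2 * (‖x - η‖:ℂ) ^ 2 / (b + ε)) = ((-(Real.pi^2*‖x-η‖^2) : ℝ) : ℂ) * (b+ε)⁻¹ := by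
          push_cast; ring
        rw [this, re_ofReal_mul, inv_re]
        have : 0 ≤ Real.pi^2*‖x-η‖^2 * ((b+ε).re / normSq (b+ε)) := by
          have := normSq_nonneg (b+ε)
          positivity
        linarith
      · refine Eventually.of_forall fun η => ?_
        refine Tendsto.mul_const _ ?_
        exact (Complex.continuous_exp.tendsto _).comp (tendsto_const_nhds.div hB hb0)
  refine tendsto_nhds_unique (hL.congr' ?_) hR
  filter_upwards [hpos] with ε hε
  exact kernel_eps u (b + ε) hε x

lemma scaling {N : ℕ} (r : ℝ) (hr : r ≠ 0) (F H : EucSp N → ℂ) (s : Set (EucSp N)) (hs : MeasurableSet s)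
    (hF : ∀ᵐ x ∂(volume : Measure (EucSp N)), ‖F x‖ = |r| ^ ((N : ℝ) / 2) * ‖H (r • x)‖) :
    eLpNorm F 2 (volume.restrict {x | r • x ∈ s}) = eLpNorm H 2 (volume.restrict s) := by
  rw [eLpNorm_eq_lintegral_rpow_enorm_toReal (by simp) (by simp), eLpNorm_eq_lintegral_rpow_enorm_toReal (by simp) (by simp)]
  congr 1
  have hm : MeasurableSet {x : EucSp N | r • x ∈ s} := measurable_const_smul r hs
  rw [← lintegral_indicator hm, ← lintegral_indicator hs]
  have e : ∀ᵐ x ∂(volume : Measure (EucSp N)), {x : EucSp N | r • x ∈ s}.indicator (fun x => ‖F x‖ₑ ^ (2:ℝ≥0∞).toReal) x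
      = ENNReal.ofReal (|r| ^ N) * s.indicator (fun x => ‖H x‖ₑ ^ (2:ℝ≥0∞).toReal) (r • x) := by
    filter_upwards [hF] with x hx
    by_cases h : r • x ∈ s
    · rw [indicator_of_mem h, indicator_of_mem (by exact h)]
      rw [← ofReal_norm, hx, ENNReal.ofReal_mul (by positivity), ofReal_norm, ENNReal.mul_rpow_of_nonneg _ _ (by simp)]
      congr 1
      rw [ENNReal.ofReal_rpow_of_nonneg (by positivity) (by simp), ← Real.rpow_mul (by positivity), ← Real.rpow_natCast]
      congr 2
      simp
    · rw [indicator_of_notMem h, indicator_of_notMem (by exact h), mul_zero]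
  rw [lintegral_congr_ae e, lintegral_const_mul' _ _ (by simp)]
  have hmap := lintegral_map_equiv (μ := (volume : Measure (EucSp N))) (s.indicator (fun x => ‖H x‖ₑ ^ (2:ℝ≥0∞).toReal)) (Homeomorph.smul (isUnit_iff_ne_zero.2 hr).unit).toMeasurableEquiv
  have : ⇑(Homeomorph.smul (α := EucSp N) (isUnit_iff_ne_zero.2 hr).unit).toMeasurableEquiv = fun x => r • x := by
    ext x; rfl
  rw [this] at hmap
  rw [← hmap]
  have := Measure.map_addHaar_smul (volume : Measure (EucSp N)) hr
  have h3 : Measure.map (fun x : EucSp N => r • x) volume = ENNReal.ofReal |(r ^ N)⁻¹| • volume := by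
    rw [finrank_euclideanSpace_fin] at this; exact this
  rw [h3, lintegral_smul_measure, smul_eq_mul, ← mul_assoc, ← ENNReal.ofReal_mul (by positivity), abs_inv, abs_pow,
    mul_inv_cancel₀ (by positivity)]
  simp

lemma eLpNorm_restrict_cont {N : ℕ} (s : Set (EucSp N)) :
    Continuous (fun v : Lp ℂ 2 (volume : Measure (EucSp N)) => eLpNorm v 2 (volume.restrict s)) := by
  have : (fun v : Lp ℂ 2 (volume : Measure (EucSp N)) => eLpNorm v 2 (volume.restrict s)) =
      fun v => ‖LpToLpRestrictCLM (EucSp N) ℂ ℂ volume 2 s v‖ₑ := by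
    ext v
    rw [Lp.enorm_def]
    exact eLpNorm_congr_ae (LpToLpRestrictCLM_coeFn ℂ s v).symm
  rw [this]
  exact (LpToLpRestrictCLM (EucSp N) ℂ ℂ volume 2 s).continuous.enorm

def ph {N : ℕ} (a : ℝ) (y : EucSp N) : ℂ := cexp (((a * ‖y‖ ^ 2 : ℝ) : ℂ) * I)

lemma norm_ph {N : ℕ} (a : ℝ) (y : EucSp N) : ‖ph a y‖ = 1 := norm_exp_ofReal_mul_I _

lemma cont_ph {N : ℕ} (a : ℝ) : Continuous (ph a : EucSp N → ℂ) := by unfold ph; fun_prop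

lemma memLp_ph {N : ℕ} (a : ℝ) {p : ℝ≥0∞} {f : EucSp N → ℂ} (hf : MemLp f p volume) :
    MemLp (fun y => ph a y * f y) p volume := by
  refine hf.of_le ((cont_ph a).aestronglyMeasurable.mul hf.1) (Eventually.of_forall fun y => ?_)
  simp [norm_ph]

def Mop {N : ℕ} (a : ℝ) (v : Lp ℂ 2 (volume : Measure (EucSp N))) : Lp ℂ 2 (volume : Measure (EucSp N)) :=
  (memLp_ph a (Lp.memLp v)).toLp _

lemma Mop_coe {N : ℕ} (a : ℝ) (v : Lp ℂ 2 (volume : Measure (EucSp N))) :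
    Mop a v =ᵐ[volume] fun y => ph a y * v y := MemLp.coeFn_toLp _

lemma Mop_isometry {N : ℕ} (a : ℝ) : Isometry (Mop (N := N) a) := by
  intro v w
  rw [Lp.edist_def, Lp.edist_def]
  refine eLpNorm_congr_norm_ae ?_
  filter_upwards [Mop_coe a v, Mop_coe a w] with y h1 h2
  simp only [Pi.sub_apply, h1, h2, ← mul_sub, norm_mul, norm_ph, one_mul]

lemma Mop_tendsto {N : ℕ} (u : Lp ℂ 2 (volume : Measure (EucSp N))) :
    Tendsto (fun a => Mop a u) (nhds 0) (nhds u) := by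
  rw [Lp.tendsto_Lp_iff_tendsto_eLpNorm']
  have e : ∀ a : ℝ, eLpNorm (⇑(Mop a u) - ⇑u) 2 volume = (∫⁻ y, ‖(ph a y - 1) * u y‖ₑ ^ (2:ℝ≥0∞).toReal) ^ (1 / (2:ℝ≥0∞).toReal) := by
    intro a
    rw [← eLpNorm_eq_lintegral_rpow_enorm_toReal (by simp) (by simp)]
    refine eLpNorm_congr_ae ?_
    filter_upwards [Mop_coe a u] with y h
    simp [h, sub_mul]
  simp only [e]
  have hu := Lp.memLp u
  have : Tendsto (fun a : ℝ => ∫⁻ y, ‖(ph a y - 1) * u y‖ₑ ^ (2:ℝ≥0∞).toReal) (nhds 0) (nhds (∫⁻ y : EucSp N, 0)) := by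
    refine tendsto_lintegral_filter_of_dominated_convergence' (fun y => ‖2 * u y‖ₑ ^ (2:ℝ≥0∞).toReal) ?_ ?_ ?_ ?_
    · refine Eventually.of_forall fun a => ?_
      exact ((((cont_ph a).sub continuous_const).aestronglyMeasurable.mul hu.1).enorm).pow_const _
    · refine Eventually.of_forall fun a => Eventually.of_forall fun y => ?_
      refine ENNReal.rpow_le_rpow ?_ (by simp)
      rw [enorm_le_iff_norm_le, norm_mul, norm_mul]
      refine mul_le_mul_of_nonneg_right ?_ (norm_nonneg _)
      refine (norm_sub_le _ _).trans ?_
      rw [norm_ph]; norm_num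
    · have := lintegral_rpow_enorm_lt_top_of_eLpNorm_lt_top (p := 2) (by simp) (by simp) (hu.const_mul (2:ℂ)).2
      exact this.ne
    · refine Eventually.of_forall fun y => ?_
      have : Continuous fun a : ℝ => ‖(ph a y - 1) * u y‖ₑ ^ (2:ℝ≥0∞).toReal := by
        unfold ph
        refine (ENNReal.continuous_rpow_const).comp ?_
        exact Continuous.enorm (by fun_prop)
      have := this.tendsto 0
      simpa [ph] using this
  have h2 := (ENNReal.continuous_rpow_const (y := 1 / (2:ℝ≥0∞).toReal)).tendsto _ |>.comp this
  simpa [Function.comp_def] using h2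

open FourierTransform SchwartzMap in
def gS {N : ℕ} (u : 𝓢(EucSp N, ℂ)) (ξ : EucSp N) : ℂ :=
  ((2 * Real.pi : ℝ) ^ (-(N : ℝ) / 2) : ℝ) * 𝓕 u ((2 * Real.pi)⁻¹ • ξ)

lemma two_pi_pow (N : ℕ) : (2 * Real.pi : ℝ) ^ (-(N : ℝ) / 2) * ((2 * Real.pi : ℝ) ^ (-(N : ℝ) / 2) * (2 * Real.pi) ^ N) = 1 := by
  have h : (0:ℝ) < 2 * Real.pi := by positivity
  rw [← Real.rpow_natCast, ← Real.rpow_add h, ← Real.rpow_add h]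
  rw [show -(N : ℝ) / 2 + (-(N : ℝ) / 2 + N) = 0 by ring, Real.rpow_zero]

open FourierTransform SchwartzMap in
lemma gS_int {N : ℕ} (u : 𝓢(EucSp N, ℂ)) (t : ℝ) (x : EucSp N) :
    ((2 * Real.pi : ℝ) ^ (-(N : ℝ) / 2) : ℝ) *
      ∫ ξ, cexp (I * (⟪x, ξ⟫ : ℝ)) * (cexp (-I * (t : ℂ) * ((‖ξ‖ : ℝ) ^ 2 : ℝ)) * gS u ξ)
    = ∫ η, cexp (-(4 * Real.pi ^ 2 * t * I) * ‖η‖ ^ 2 + 2 * Real.pi * Complex.I * (⟪x, η⟫ : ℝ)) * (𝓕 (u : EucSp N → ℂ)) η := by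
  have hpos : (0:ℝ) < 2 * Real.pi := by positivity
  have h := Measure.integral_comp_inv_smul (volume : Measure (EucSp N)) (fun η => cexp (-(4 * Real.pi ^ 2 * t * I) * ‖η‖ ^ 2 + 2 * Real.pi * Complex.I * (⟪x, η⟫ : ℝ)) * (𝓕 (u : EucSp N → ℂ)) η) (2 * Real.pi)
  have e : ∀ ξ : EucSp N, cexp (I * (⟪x, ξ⟫ : ℝ)) * (cexp (-I * (t : ℂ) * ((‖ξ‖ : ℝ) ^ 2 : ℝ)) * gS u ξ)
     = ((2 * Real.pi : ℝ) ^ (-(N : ℝ) / 2) : ℝ) * (cexp (-(4 * Real.pi ^ 2 * t * I) * ‖(2 * Real.pi)⁻¹ • ξ‖ ^ 2 + 2 * Real.pi * Complex.I * (⟪x, (2 * Real.pi)⁻¹ • ξ⟫ : ℝ)) * (𝓕 (u : EucSp N → ℂ)) ((2 * Real.pi)⁻¹ • ξ)) := by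
    intro ξ
    unfold gS
    rw [← SchwartzMap.fourier_coe, ← mul_assoc, ← Complex.exp_add]
    have : I * (⟪x, ξ⟫ : ℝ) + -I * (t : ℂ) * ((‖ξ‖ : ℝ) ^ 2 : ℝ) = -(4 * Real.pi ^ 2 * t * I) * ‖(2 * Real.pi)⁻¹ • ξ‖ ^ 2 + 2 * Real.pi * Complex.I * (⟪x, (2 * Real.pi)⁻¹ • ξ⟫ : ℝ) := by
      rw [norm_smul, inner_smul_right, Real.norm_of_nonneg (by positivity)]
      have : (Real.pi : ℂ) ≠ 0 := by simp [Real.pi_ne_zero]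
      push_cast
      field_simp
      ring
    rw [this]; ring
  rw [integral_congr_ae (Eventually.of_forall e), integral_const_mul, h, finrank_euclideanSpace_fin,
    abs_of_nonneg (by positivity), real_smul, ← mul_assoc, ← mul_assoc, ← Complex.ofReal_mul, ← Complex.ofReal_mul, mul_assoc, two_pi_pow]
  simp

open FourierTransform SchwartzMap in
lemma gS_integrable {N : ℕ} (u : 𝓢(EucSp N, ℂ)) : Integrable (gS u) volume := by
  have h := (𝓕 u).integrable (μ := volume)
  exact ((integrable_comp_smul_iff volume _ (inv_ne_zero (by positivity : (2 * Real.pi : ℝ) ≠ 0))).2 h).const_mul _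

open FourierTransform SchwartzMap in
lemma gS_cont {N : ℕ} (u : 𝓢(EucSp N, ℂ)) : Continuous (gS u) := by
  have h := (𝓕 u).continuous
  unfold gS; fun_prop

open FourierTransform SchwartzMap in
lemma gS_memLp {N : ℕ} (u : 𝓢(EucSp N, ℂ)) : MemLp (gS u) 2 volume := by
  obtain ⟨C, hC⟩ := (𝓕 u).decay 0 0
  have hC2 : ∀ y, ‖𝓕 u y‖ ≤ C := by simpa using hC.2
  rw [memLp_two_iff_integrable_sq_norm (gS_cont u).aestronglyMeasurable]
  have := (gS_integrable u).norm.const_mul ((2 * Real.pi : ℝ) ^ (-(N : ℝ) / 2) * C)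
  refine this.mono' (by have := gS_cont u; exact Continuous.aestronglyMeasurable (by fun_prop)) (Eventually.of_forall fun ξ => ?_)
  rw [Real.norm_of_nonneg (by positivity), sq]
  refine mul_le_mul_of_nonneg_right ?_ (norm_nonneg _)
  unfold gS
  rw [norm_mul, norm_real, Real.norm_of_nonneg (by positivity)]
  exact mul_le_mul_of_nonneg_left (hC2 _) (by positivity)

set_option maxHeartbeats 1000000 in
open FourierTransform SchwartzMap in
lemma schwartz_case {N : ℕ}
    (Finv : Lp ℂ 2 (volume : Measure (EucSp N)) ≃ₗᵢ[ℂ] Lp ℂ 2 (volume : Measure (EucSp N)))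
    (hFinv : ∀ (g : EucSp N → ℂ) (hg1 : Integrable g (volume : Measure (EucSp N)))
      (hg2 : MemLp g 2 (volume : Measure (EucSp N))),
      ⇑(Finv (hg2.toLp g)) =ᵐ[(volume : Measure (EucSp N))]
        fun x => ((2 * Real.pi : ℝ) ^ (-(N : ℝ) / 2) : ℝ) *
          ∫ ξ, Complex.exp (Complex.I * (⟪x, ξ⟫ : ℝ)) * g ξ)
    (U : ℝ → (Lp ℂ 2 (volume : Measure (EucSp N)) ≃ₗᵢ[ℂ] Lp ℂ 2 (volume : Measure (EucSp N))))
    (hU : ∀ (t : ℝ) (v : Lp ℂ 2 (volume : Measure (EucSp N))),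
      ⇑(Finv.symm (U t v)) =ᵐ[(volume : Measure (EucSp N))]
        fun ξ => Complex.exp (-Complex.I * (t : ℂ) * ((‖ξ‖ : ℝ) ^ 2 : ℝ)) * (Finv.symm v) ξ)
    (t : ℝ) (ht : t ≠ 0) (u : 𝓢(EucSp N, ℂ)) (s : Set (EucSp N)) (hs : MeasurableSet s) :
    eLpNorm (U t (u.toLp 2)) 2 (volume.restrict {x | (-(2 * t)⁻¹) • x ∈ s}) =
      eLpNorm (Finv (Mop (4 * t)⁻¹ (u.toLp 2))) 2 (volume.restrict s) := by
  have h0 : Finv.symm (u.toLp 2) = (gS_memLp u).toLp _ := by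
    rw [LinearIsometryEquiv.symm_apply_eq]
    refine Lp.ext ?_
    filter_upwards [hFinv _ (gS_integrable u) (gS_memLp u), u.coeFn_toLp 2 volume] with x h1 h2
    rw [h1, h2]
    have h3 := gS_int u 0 x
    simp only [Complex.ofReal_zero, mul_zero, zero_mul, neg_zero, Complex.exp_zero, one_mul, zero_add] at h3
    rw [h3]
    have h4 : 𝓕⁻ (𝓕 u) x = u x := by simp
    rw [← h4, SchwartzMap.fourierInv_coe, Real.fourierInv_eq', SchwartzMap.fourier_coe]
    refine integral_congr_ae (Eventually.of_forall fun η => ?_)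
    simp only [smul_eq_mul, real_inner_comm x η]
    congr 2
    push_cast; ring
  have hph : ∀ ξ : EucSp N, cexp (-I * (t : ℂ) * ((‖ξ‖ : ℝ) ^ 2 : ℝ)) = ph (-t) ξ := by
    intro ξ; unfold ph; congr 1; push_cast; ring
  have hg2 := memLp_ph (-t) (gS_memLp u)
  have hg1 : Integrable (fun y => ph (-t) y * gS u y) volume :=
    memLp_one_iff_integrable.1 (memLp_ph (-t) (memLp_one_iff_integrable.2 (gS_integrable u)))
  have h1 : U t (u.toLp 2) = Finv (hg2.toLp _) := by
    rw [← LinearIsometryEquiv.symm_apply_eq]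
    refine Lp.ext ?_
    filter_upwards [hU t (u.toLp 2), hg2.coeFn_toLp, (gS_memLp u).coeFn_toLp] with x h1 h2 h3
    rw [h1, h2, h0, h3, hph]
  have hm2 : MemLp (fun y => ph (4 * t)⁻¹ y * u y) 2 volume := memLp_ph _ (u.memLp 2 volume)
  have hm1 : Integrable (fun y => ph (4 * t)⁻¹ y * u y) volume :=
    memLp_one_iff_integrable.1 (memLp_ph _ (u.memLp 1 volume))
  have h2 : Mop (4 * t)⁻¹ (u.toLp 2) = hm2.toLp _ := by
    refine Lp.ext ?_
    filter_upwards [Mop_coe (4 * t)⁻¹ (u.toLp 2), hm2.coeFn_toLp, u.coeFn_toLp 2 volume] with x h1 h2 h3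
    rw [h1, h2, h3]
  rw [h1, h2, eLpNorm_congr_ae (ae_restrict_of_ae (hFinv _ hm1 hm2))]
  refine scaling _ (neg_ne_zero.2 (inv_ne_zero (by simpa using ht))) _ _ s hs ?_
  filter_upwards [hFinv _ hg1 hg2] with x hx
  rw [hx]
  simp only [← hph]
  rw [gS_int, kernel u t ht]
  have hpi : (Real.pi : ℂ) ≠ 0 := by simp [Real.pi_ne_zero]
  have htc : (t : ℂ) ≠ 0 := by simp [ht]
  have e : ∀ y : EucSp N, cexp (-Real.pi ^ 2 * ‖x - y‖ ^ 2 / (4 * Real.pi ^ 2 * t * I)) * u y =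
      ph (4 * t)⁻¹ x * (cexp (I * (⟪(-(2 * t)⁻¹) • x, y⟫ : ℝ)) * (ph (4 * t)⁻¹ y * u y)) := by
    intro y
    unfold ph
    rw [← mul_assoc, ← mul_assoc, ← Complex.exp_add, ← Complex.exp_add]
    congr 2
    rw [inner_smul_left]
    have : (‖x - y‖ : ℂ) ^ 2 = ‖x‖ ^ 2 - 2 * (⟪x, y⟫ : ℝ) + ‖y‖ ^ 2 := by
      have := norm_sub_sq_real x y
      exact_mod_cast this
    rw [this]
    simp only [conj_trivial]
    push_cast
    field_simp
    simp only [I_sq]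
    ring
  rw [integral_congr_ae (Eventually.of_forall e), integral_const_mul, norm_mul, norm_mul, norm_mul, norm_ph, one_mul, ← mul_assoc]
  congr 1
  rw [show (N / 2 : ℂ) = ((N / 2 : ℝ) : ℂ) by push_cast; rfl, norm_cpow_real, norm_real,
    Real.norm_of_nonneg (by positivity)]
  have e2 : ‖(Real.pi / (4 * Real.pi ^ 2 * t * I) : ℂ)‖ = (2 * Real.pi)⁻¹ * |-(2 * t)⁻¹| := by
    have : (Real.pi / (4 * Real.pi ^ 2 * t * I) : ℂ) = ((2 * Real.pi)⁻¹ * (-(2 * t)⁻¹) : ℝ) * I := by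
      push_cast; field_simp; simp; norm_num
    rw [this, norm_mul, norm_I, mul_one, norm_real, norm_mul, Real.norm_of_nonneg (by positivity)]; rfl
  rw [e2, Real.mul_rpow (by positivity) (by positivity), Real.inv_rpow (by positivity), ← Real.rpow_neg (by positivity), mul_comm, neg_div, mul_comm]

lemma general_case {N : ℕ}
    (Finv : Lp ℂ 2 (volume : Measure (EucSp N)) ≃ₗᵢ[ℂ] Lp ℂ 2 (volume : Measure (EucSp N)))
    (hFinv : ∀ (g : EucSp N → ℂ) (hg1 : Integrable g (volume : Measure (EucSp N)))
      (hg2 : MemLp g 2 (volume : Measure (EucSp N))),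
      ⇑(Finv (hg2.toLp g)) =ᵐ[(volume : Measure (EucSp N))]
        fun x => ((2 * Real.pi : ℝ) ^ (-(N : ℝ) / 2) : ℝ) *
          ∫ ξ, Complex.exp (Complex.I * (⟪x, ξ⟫ : ℝ)) * g ξ)
    (U : ℝ → (Lp ℂ 2 (volume : Measure (EucSp N)) ≃ₗᵢ[ℂ] Lp ℂ 2 (volume : Measure (EucSp N))))
    (hU : ∀ (t : ℝ) (v : Lp ℂ 2 (volume : Measure (EucSp N))),
      ⇑(Finv.symm (U t v)) =ᵐ[(volume : Measure (EucSp N))]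
        fun ξ => Complex.exp (-Complex.I * (t : ℂ) * ((‖ξ‖ : ℝ) ^ 2 : ℝ)) * (Finv.symm v) ξ)
    (t : ℝ) (ht : t ≠ 0) (v : Lp ℂ 2 (volume : Measure (EucSp N))) (s : Set (EucSp N)) (hs : MeasurableSet s) :
    eLpNorm (U t v) 2 (volume.restrict {x | (-(2 * t)⁻¹) • x ∈ s}) =
      eLpNorm (Finv (Mop (4 * t)⁻¹ v)) 2 (volume.restrict s) := by
  refine DenseRange.induction_on (p := fun v => eLpNorm (U t v) 2 (volume.restrict {x | (-(2 * t)⁻¹) • x ∈ s}) =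
      eLpNorm (Finv (Mop (4 * t)⁻¹ v)) 2 (volume.restrict s))
    (SchwartzMap.denseRange_toLpCLM (p := 2) (F := ℂ) (E := EucSp N) (μ := volume) ENNReal.ofNat_ne_top) v ?_ ?_
  · refine isClosed_eq ?_ ?_
    · exact (eLpNorm_restrict_cont _).comp (U t).continuous
    · exact (eLpNorm_restrict_cont _).comp (Finv.continuous.comp (Mop_isometry _).continuous)
  · intro u
    exact schwartz_case Finv hFinv U hU t ht u s hs

/-- **Strauss's annulus limit for the free Schrödinger group (Bégout, Remark 2.10,
estimate (2.15)).** Let `N ≥ 1`, let `Finv` be the inverse Fourier transform on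
`L²(ℝ^N)` (the unitary extension of `g ↦ (2π)^{-N/2} ∫ e^{i x·ξ} g(ξ) dξ`) and let
`(e^{itΔ})_{t∈ℝ}` be the free Schrödinger group on `L²(ℝ^N)`, i.e.
`ℱ(e^{itΔ}v)(ξ) = e^{-it|ξ|²} ℱv(ξ)` where `ℱ = Finv⁻¹`. Then for every
`u₀ ∈ L²(ℝ^N)` and all `k > k' ≥ 0`,
`lim_{t→±∞} ‖e^{itΔ}u₀‖_{L²({k'|t| < |x| < k|t|})} = ‖Finv u₀‖_{L²({k'/2 < |x| < k/2})}`. -/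
theorem free_schroedinger_annulus_limit (N : ℕ) (hN : 1 ≤ N)
    (Finv : Lp ℂ 2 (volume : Measure (EucSp N)) ≃ₗᵢ[ℂ] Lp ℂ 2 (volume : Measure (EucSp N)))
    (hFinv : ∀ (g : EucSp N → ℂ) (hg1 : Integrable g (volume : Measure (EucSp N)))
      (hg2 : MemLp g 2 (volume : Measure (EucSp N))),
      ⇑(Finv (hg2.toLp g)) =ᵐ[(volume : Measure (EucSp N))]
        fun x => ((2 * Real.pi : ℝ) ^ (-(N : ℝ) / 2) : ℝ) *
          ∫ ξ, Complex.exp (Complex.I * (⟪x, ξ⟫ : ℝ)) * g ξ)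
    (U : ℝ → (Lp ℂ 2 (volume : Measure (EucSp N)) ≃ₗᵢ[ℂ] Lp ℂ 2 (volume : Measure (EucSp N))))
    (hU : ∀ (t : ℝ) (v : Lp ℂ 2 (volume : Measure (EucSp N))),
      ⇑(Finv.symm (U t v)) =ᵐ[(volume : Measure (EucSp N))]
        fun ξ => Complex.exp (-Complex.I * (t : ℂ) * ((‖ξ‖ : ℝ) ^ 2 : ℝ)) * (Finv.symm v) ξ)
    (u₀ : Lp ℂ 2 (volume : Measure (EucSp N))) (k k' : ℝ) (hk' : 0 ≤ k') (hk : k' < k) :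
    Tendsto (fun t : ℝ => eLpNorm (U t u₀) 2
        (volume.restrict {x : EucSp N | k' * |t| < ‖x‖ ∧ ‖x‖ < k * |t|}))
      atTop (nhds (eLpNorm (Finv u₀) 2
        (volume.restrict {x : EucSp N | k' / 2 < ‖x‖ ∧ ‖x‖ < k / 2}))) ∧
    Tendsto (fun t : ℝ => eLpNorm (U t u₀) 2
        (volume.restrict {x : EucSp N | k' * |t| < ‖x‖ ∧ ‖x‖ < k * |t|}))
      atBot (nhds (eLpNorm (Finv u₀) 2
        (volume.restrict {x : EucSp N | k' / 2 < ‖x‖ ∧ ‖x‖ < k / 2}))) := by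
  have key : ∀ l : Filter ℝ, Tendsto (fun t : ℝ => t⁻¹) l (nhds 0) → (∀ᶠ t in l, t ≠ 0) →
      Tendsto (fun t : ℝ => eLpNorm (U t u₀) 2
        (volume.restrict {x : EucSp N | k' * |t| < ‖x‖ ∧ ‖x‖ < k * |t|}))
      l (nhds (eLpNorm (Finv u₀) 2
        (volume.restrict {x : EucSp N | k' / 2 < ‖x‖ ∧ ‖x‖ < k / 2}))) := by
    intro l hl hne
    set s : Set (EucSp N) := {x : EucSp N | k' / 2 < ‖x‖ ∧ ‖x‖ < k / 2} with hsdef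
    have hs : MeasurableSet s :=
      (measurableSet_lt measurable_const measurable_norm).inter
        (measurableSet_lt measurable_norm measurable_const)
    have h1 : Tendsto (fun t : ℝ => (4 * t)⁻¹) l (nhds 0) := by
      simpa [mul_inv] using hl.mul_const (4 : ℝ)⁻¹
    have h2 := ((eLpNorm_restrict_cont s).comp Finv.continuous).tendsto u₀ |>.comp
      ((Mop_tendsto u₀).comp h1)
    refine h2.congr' ?_
    filter_upwards [hne] with t ht
    have h3 := general_case Finv hFinv U hU t ht u₀ s hs
    simp only [Function.comp_apply]
    rw [← h3]
    congr 2
    ext x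
    have hp : 0 < |t| := abs_pos.2 ht
    simp only [hsdef, mem_ofPred_eq, norm_smul, norm_neg, norm_inv, norm_mul, Real.norm_eq_abs,
      Nat.abs_ofNat]
    rw [inv_mul_eq_div, div_lt_div_iff₀ (by positivity) (by positivity),
      div_lt_div_iff₀ (by positivity) (by positivity)]
    constructor <;> rintro ⟨ha, hb⟩ <;> constructor <;> linarith
  exact ⟨key atTop tendsto_inv_atTop_zero (eventually_ne_atTop 0),
    key atBot tendsto_inv_atBot_zero (eventually_ne_atBot 0)⟩

end
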